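/- For every integer n ≥ 0, F̂_{n+1}(q) = Σ_{j ∈ ℤ} (−1)^j q^{j(5j−3)/2} · [n+1 choose ⌊(n+1−5j)/2⌋ + 1]_q in ℤ[q], where the sum has only finitely many nonzero terms since the q-binomial coefficient vanishes when ⌊(n+1−5j)/2⌋ + 1 < 0 or ⌊(n+1−5j)/2⌋ + 1 > n+1, and j(5j−3)/2 ≥ 0 for all j ∈ ℤ. -/

import Mathlib

open Polynomial

/-- The q-Fibonacci polynomials: F̂₀ = 0, F̂₁ = 1, F̂ₙ = F̂ₙ₋₁ + q^(n-1) F̂ₙ₋₂. -/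
noncomputable def qFhat : ℕ → Polynomial ℤ
  | 0 => 0
  | 1 => 1
  | n + 2 => qFhat (n + 1) + X ^ (n + 1) * qFhat n
/-- The Gaussian (q-)binomial coefficient [n choose m]_q ∈ ℤ[q], defined via the
Pascal-type recurrence [n+1 choose m]_q = q^m [n choose m]_q + [n choose m-1]_q;
it equals ((1-q^n)⋯(1-q^(n-m+1)))/((1-q^m)⋯(1-q)) for 0 ≤ m ≤ n and is 0 for m > n. -/
noncomputable def qbinom : ℕ → ℕ → Polynomial ℤ
  | _, 0 => 1
  | 0, _ + 1 => 0
  | n + 1, m + 1 => X ^ (m + 1) * qbinom n (m + 1) + qbinom n m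
/-- The q-binomial coefficient with an integer lower index, which is 0 when that index
is negative. -/
noncomputable def qbinomZ (n : ℕ) (m : ℤ) : Polynomial ℤ :=
  if 0 ≤ m then qbinom n m.toNat else 0

lemma qbinom_eq_zero' : ∀ n m : ℕ, n < m → qbinom n m = 0
  | _, 0, h => by omega
  | 0, _ + 1, _ => by simp [qbinom]
  | n + 1, m + 1, h => by
    rw [qbinom, qbinom_eq_zero' n (m + 1) (by omega), qbinom_eq_zero' n m (by omega)]
    simp

lemma qbinom_pascal2 (n : ℕ) : ∀ m : ℕ,
    qbinom (n + 1) (m + 1) = qbinom n (m + 1) + X ^ (n - m) * qbinom n m := by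
  induction n with
  | zero => intro m; cases m <;> simp [qbinom]
  | succ n ih =>
    intro m
    rw [qbinom, ih m]
    cases m with
    | zero =>
      have h := ih 0
      simp only [qbinom] at h ⊢
      simp only [Nat.sub_zero] at h ⊢
      linear_combination h
    | succ m =>
      have e1 : qbinom (n+1) (m+1+1) = X ^ (m+1+1) * qbinom n (m+1+1) + qbinom n (m+1) := by
        rw [qbinom]
      have e2 : qbinom (n+1) (m+1) = X ^ (m+1) * qbinom n (m+1) + qbinom n m := by
        rw [qbinom]
      have e3 := ih m
      have e4 := ih (m + 1)
      rw [e1] at e4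
      rw [Nat.add_sub_add_right]
      by_cases hm : m + 1 ≤ n
      · obtain ⟨d, rfl⟩ := Nat.exists_eq_add_of_le hm
        have a1 : m + 1 + d - (m + 1) = d := by omega
        have a2 : m + 1 + d - m = d + 1 := by omega
        rw [a1] at e4 ⊢
        rw [a2] at e3 ⊢
        linear_combination e4 + e3 - X ^ (d + 1) * e2
      · have z := qbinom_eq_zero' n (m+1) (by omega)
        rw [z] at e2 e3 e4 ⊢
        linear_combination e4 + e3 - X ^ (n - m) * e2

lemma qbinomZ_eq_zero (n : ℕ) (m : ℤ) (h : m < 0 ∨ (n : ℤ) < m) : qbinomZ n m = 0 := by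
  unfold qbinomZ
  split_ifs with h0
  · exact qbinom_eq_zero' _ _ (by omega)
  · rfl

lemma qbinomZ_nat (n m : ℕ) : qbinomZ n (m : ℤ) = qbinom n m := by
  simp [qbinomZ]

lemma qbinomZ_p1 (n : ℕ) (m : ℤ) :
    qbinomZ (n + 1) m = X ^ m.toNat * qbinomZ n m + qbinomZ n (m - 1) := by
  rcases lt_trichotomy m 0 with h | h | h
  · rw [qbinomZ_eq_zero _ _ (.inl h), qbinomZ_eq_zero _ _ (.inl h),
      qbinomZ_eq_zero _ (m - 1) (.inl (by omega))]; simp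
  · subst h
    rw [qbinomZ_eq_zero _ (0 - 1) (.inl (by omega))]
    simp [qbinomZ, qbinom]
  · obtain ⟨k, rfl⟩ : ∃ k : ℕ, m = ((k + 1 : ℕ) : ℤ) := ⟨(m - 1).toNat, by omega⟩
    have : (((k + 1 : ℕ) : ℤ) - 1) = (k : ℤ) := by push_cast; ring
    rw [this, qbinomZ_nat, qbinomZ_nat, qbinomZ_nat, Int.toNat_natCast, qbinom]

lemma qbinomZ_p2 (n : ℕ) (m : ℤ) :
    qbinomZ (n + 1) m = qbinomZ n m + X ^ ((n : ℤ) + 1 - m).toNat * qbinomZ n (m - 1) := by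
  rcases lt_trichotomy m 0 with h | h | h
  · rw [qbinomZ_eq_zero _ _ (.inl h), qbinomZ_eq_zero _ _ (.inl h),
      qbinomZ_eq_zero _ (m - 1) (.inl (by omega))]; simp
  · subst h
    rw [qbinomZ_eq_zero _ (0 - 1) (.inl (by omega))]
    simp [qbinomZ, qbinom]
  · obtain ⟨k, rfl⟩ : ∃ k : ℕ, m = ((k + 1 : ℕ) : ℤ) := ⟨(m - 1).toNat, by omega⟩
    have : (((k + 1 : ℕ) : ℤ) - 1) = (k : ℤ) := by push_cast; ring
    have h2 : ((n : ℤ) + 1 - ((k + 1 : ℕ) : ℤ)).toNat = n - k := by omega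
    rw [this, h2, qbinomZ_nat, qbinomZ_nat, qbinomZ_nat, qbinom_pascal2]

lemma two_mul_ee (j : ℤ) : 2 * (j * (5 * j - 3) / 2) = j * (5 * j - 3) := by
  apply Int.mul_ediv_cancel'
  rcases Int.even_or_odd' j with ⟨k, rfl | rfl⟩
  · exact ⟨k * (5 * (2 * k) - 3), by ring⟩
  · exact ⟨(2 * k + 1) * (5 * k + 1), by ring⟩

lemma ee_nonneg (j : ℤ) : 0 ≤ j * (5 * j - 3) / 2 := by
  have h := two_mul_ee j
  have : 0 ≤ j * (5 * j - 3) := by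
    rcases le_or_gt j 0 with h | h
    · exact mul_nonneg_of_nonpos_of_nonpos h (by omega)
    · exact mul_nonneg (by omega) (by omega)
  omega

/-- The summand. -/
noncomputable def fterm (n : ℕ) (j : ℤ) : Polynomial ℤ :=
  C ((j.negOnePow : ℤˣ) : ℤ) * X ^ (j * (5 * j - 3) / 2).toNat *
    qbinomZ n (((n : ℤ) - 5 * j) / 2 + 1)

/-- The telescoping part. -/
noncomputable def gterm (n : ℕ) (j : ℤ) : Polynomial ℤ :=
  if ((n : ℤ) - 5 * j) % 2 = 0 then
    C ((j.negOnePow : ℤˣ) : ℤ) * X ^ (j * (5 * j - 3) / 2).toNat *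
      (X ^ (((n : ℤ) - 5 * j) / 2 + 2).toNat * qbinomZ n (((n : ℤ) - 5 * j) / 2 + 2))
  else 0

lemma fterm_fin (n : ℕ) : (Function.support (fterm n)).Finite := by
  apply (Set.finite_Icc (-(n : ℤ) - 5) (n + 5)).subset
  intro j hj
  by_contra hc
  apply hj
  rw [Set.mem_Icc] at hc
  unfold fterm
  rw [qbinomZ_eq_zero _ _ (by omega), mul_zero]

lemma gterm_fin (n : ℕ) : (Function.support (gterm n)).Finite := by
  apply (Set.finite_Icc (-(n : ℤ) - 5) (n + 5)).subset
  intro j hj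
  by_contra hc
  apply hj
  rw [Set.mem_Icc] at hc
  unfold gterm
  rw [qbinomZ_eq_zero _ _ (by omega), mul_zero, mul_zero, ite_self]

lemma gterm_succ_fin (n : ℕ) : (Function.support (fun j => gterm n (j + 1))).Finite := by
  apply (Set.finite_Icc (-(n : ℤ) - 6) (n + 6)).subset
  intro j hj
  by_contra hc
  apply hj
  rw [Set.mem_Icc] at hc
  simp only [gterm]
  rw [qbinomZ_eq_zero _ _ (by omega), mul_zero, mul_zero, ite_self]

lemma fterm_rec (n : ℕ) (j : ℤ) :
    fterm (n + 2) j = fterm (n + 1) j + X ^ (n + 1) * fterm n j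
      + (gterm n j - gterm n (j + 1)) := by
  unfold fterm gterm
  obtain ⟨k, hk⟩ : ∃ k : ℤ, ((n : ℤ) - 5 * j) / 2 + 1 = k := ⟨_, rfl⟩
  have hk2 : ((n : ℤ) - 5 * j) / 2 + 2 = k + 1 := by omega
  have hk3 : (((n + 2 : ℕ) : ℤ) - 5 * j) / 2 + 1 = k + 1 := by push_cast; omega
  rw [hk, hk2, hk3]
  rcases Int.emod_two_eq_zero_or_one ((n : ℤ) - 5 * j) with h | h
  · have h1 : (((n + 1 : ℕ) : ℤ) - 5 * j) / 2 + 1 = k := by push_cast; omega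
    rw [h1, if_pos h, if_neg (by omega), qbinomZ_p1 (n + 1) (k + 1), qbinomZ_p2 n (k + 1),
      add_sub_cancel_right]
    have key : (X : Polynomial ℤ) ^ (k + 1).toNat * (X ^ ((n : ℤ) + 1 - (k + 1)).toNat * qbinomZ n k)
        = X ^ (n + 1) * qbinomZ n k := by
      by_cases hc : k < 0 ∨ (n : ℤ) < k
      · rw [qbinomZ_eq_zero _ _ hc]; simp
      · rw [← mul_assoc, ← pow_add]; congr 2; omega
    linear_combination (C ((j.negOnePow : ℤˣ) : ℤ) * X ^ (j * (5 * j - 3) / 2).toNat) * key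
  · have h1 : (((n + 1 : ℕ) : ℤ) - 5 * j) / 2 + 1 = k + 1 := by push_cast; omega
    have h2 : ((n : ℤ) - 5 * (j + 1)) / 2 + 2 = k - 1 := by omega
    rw [h1, h2, if_neg (by omega), if_pos (by omega), qbinomZ_p2 (n + 1) (k + 1),
      add_sub_cancel_right, qbinomZ_p1 n k, Int.negOnePow_succ]
    have key : (X : Polynomial ℤ) ^ (((n + 1 : ℕ) : ℤ) + 1 - (k + 1)).toNat * (X ^ k.toNat * qbinomZ n k)
        = X ^ (n + 1) * qbinomZ n k := by
      by_cases hc : k < 0 ∨ (n : ℤ) < k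
      · rw [qbinomZ_eq_zero _ _ hc]; simp
      · rw [← mul_assoc, ← pow_add]; congr 2; omega
    have key2 : (X : Polynomial ℤ) ^ (j * (5 * j - 3) / 2).toNat *
          (X ^ (((n + 1 : ℕ) : ℤ) + 1 - (k + 1)).toNat * qbinomZ n (k - 1))
        = X ^ ((j + 1) * (5 * (j + 1) - 3) / 2).toNat * (X ^ (k - 1).toNat * qbinomZ n (k - 1)) := by
      by_cases hc : k - 1 < 0 ∨ (n : ℤ) < k - 1
      · rw [qbinomZ_eq_zero _ _ hc]; simp
      · rw [← mul_assoc, ← pow_add, ← mul_assoc, ← pow_add]; congr 2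
        have a1 := two_mul_ee j
        have a2 := two_mul_ee (j + 1)
        have b1 := ee_nonneg j
        have b2 := ee_nonneg (j + 1)
        have a3 : (j + 1) * (5 * (j + 1) - 3) = j * (5 * j - 3) + 10 * j + 2 := by ring
        omega
    have hs : C (((-j.negOnePow : ℤˣ)) : ℤ) = -C ((j.negOnePow : ℤˣ) : ℤ) := by simp
    rw [hs]
    linear_combination (C ((j.negOnePow : ℤˣ) : ℤ) * X ^ (j * (5 * j - 3) / 2).toNat) * key
      + C ((j.negOnePow : ℤˣ) : ℤ) * key2

lemma fsum_rec (n : ℕ) :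
    ∑ᶠ j, fterm (n + 2) j = ∑ᶠ j, fterm (n + 1) j + X ^ (n + 1) * ∑ᶠ j, fterm n j := by
  have hX : (Function.support (fun j => X ^ (n + 1) * fterm n j)).Finite :=
    (fterm_fin n).subset (Function.support_mul_subset_right _ _)
  have hg : ∑ᶠ j, gterm n (j + 1) = ∑ᶠ j, gterm n j :=
    finsum_comp_equiv (Equiv.addRight (1 : ℤ))
  rw [finsum_congr (fterm_rec n), finsum_add_distrib, finsum_add_distrib (fterm_fin _) hX,
    finsum_sub_distrib (gterm_fin n) (gterm_succ_fin n), hg, sub_self, add_zero, mul_finsum]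
  · exact ((fterm_fin _).union hX).subset (Function.support_add _ _)
  · exact ((gterm_fin n).union (gterm_succ_fin n)).subset (Function.support_sub _ _)

lemma qFhat_eq : ∀ n : ℕ, qFhat n = ∑ᶠ j, fterm n j
  | 0 => by
    rw [qFhat, eq_comm]
    apply finsum_eq_zero_of_forall_eq_zero
    intro j
    unfold fterm
    rw [qbinomZ_eq_zero _ _ (by push_cast; omega), mul_zero]
  | 1 => by
    rw [finsum_eq_single _ (0 : ℤ)]
    · simp [fterm, qFhat, qbinomZ, qbinom]
    · intro j hj
      unfold fterm
      rw [qbinomZ_eq_zero _ _ (by push_cast; omega), mul_zero]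
  | n + 2 => by
    rw [qFhat, fsum_rec, ← qFhat_eq (n + 1), ← qFhat_eq n]

/-- For n ≥ 0, j(5j−3)/2 ≥ 0 for all j ∈ ℤ and
F̂_{n+1}(q) = Σ_{j ∈ ℤ} (−1)^j q^(j(5j−3)/2) [n+1 choose ⌊(n+1−5j)/2⌋+1]_q,
the sum having finitely many nonzero terms. -/
theorem qFibHat_alternating_sum_formula (n : ℕ) :
    (∀ j : ℤ, 0 ≤ j * (5 * j - 3) / 2) ∧
      qFhat (n + 1) = ∑ᶠ j : ℤ,
        C ((j.negOnePow : ℤˣ) : ℤ) * X ^ (j * (5 * j - 3) / 2).toNat *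
          qbinomZ (n + 1) (((n : ℤ) + 1 - 5 * j) / 2 + 1) := by
  refine ⟨ee_nonneg, ?_⟩
  rw [qFhat_eq]
  apply finsum_congr
  intro j
  unfold fterm
  push_cast
  rfl
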